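/- Define P_0 to be the tree consisting of a root with a single leaf child, and for n ≥ 1 define P_n to be the tree whose root has two children: (in order) a copy of P_{n−1}, and a node n_2 which itself has two children, a copy of P_{n−1} and a leaf. Then for all n ≥ 0, dim(P_n) = n and osc(P_n) = n + 1; hence the lower bound osc(t) − 1 ≤ dim(t) is attained with equality on this family. -/

import Mathlib

/-- The two-letter Dyck alphabet: `D.ab` is `ā` (the opening symbol) and `D.a` is `a`
(the closing symbol). -/
inductive D where
  | ab : D  -- ā
  | a : D   -- a
deriving DecidableEq

/-- Parse trees of the grammar `G_D = ({S}, {ā, a}, S, {S → ā S a S, S → ε})`: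
`eps` is an application of `S → ε` and `node t₁ t₂` an application of `S → ā S a S`. -/
inductive DyckTree where
  | eps : DyckTree
  | node : DyckTree → DyckTree → DyckTree

/-- The word generated by a parse tree of `G_D`. -/
def DyckTree.yield : DyckTree → List D
  | .eps => []
  | .node t₁ t₂ => D.ab :: (t₁.yield ++ D.a :: t₂.yield)

/-- The Dyck language `L_D`: the language generated by `G_D`. -/
def LD : Set (List D) := { w | ∃ t : DyckTree, t.yield = w }

/-- `Matches t i j` holds iff positions `i < j` (0-indexed) of the word `t.yield` form a
matching pair: position `i` carries `ā`, position `j` carries `a`, and the two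
corresponding leaves have the same parent in the parse tree `t`. -/
inductive Matches : DyckTree → ℕ → ℕ → Prop
  | head (t₁ t₂ : DyckTree) : Matches (.node t₁ t₂) 0 (t₁.yield.length + 1)
  | left {t₁ : DyckTree} {i j : ℕ} (t₂ : DyckTree) :
      Matches t₁ i j → Matches (.node t₁ t₂) (i + 1) (j + 1)
  | right {t₂ : DyckTree} {i j : ℕ} (t₁ : DyckTree) :
      Matches t₂ i j → Matches (.node t₁ t₂) (t₁.yield.length + 2 + i) (t₁.yield.length + 2 + j)

/-- `DelStep w v`: `v` results from `w ∈ L_D` by deleting (both positions of) one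
matching pair of `w`. -/
def DelStep (w v : List D) : Prop :=
  ∃ (t : DyckTree) (i j : ℕ), t.yield = w ∧ Matches t i j ∧
    v = (w.eraseIdx j).eraseIdx i

/-- The ordering `≼` on Dyck words: `dyckLE v w` (i.e. `v ≼ w`) holds iff `v` results
from `w` by deleting 0 or more matching pairs. -/
def dyckLE (v w : List D) : Prop := Relation.ReflTransGen DelStep w v

/-- The harmonics: `h_0 = ε` and `h_{i+1} = ā h_i a ā h_i a`. -/
def harmonicW : ℕ → List D
  | 0 => []
  | i + 1 => (D.ab :: (harmonicW i ++ [D.a])) ++ (D.ab :: (harmonicW i ++ [D.a]))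

/-- `ĥ_i = ā h_i a`. -/
def hatHarmonic (i : ℕ) : List D := D.ab :: (harmonicW i ++ [D.a])

/-- The rank of a Dyck word `w`: the greatest `q` such that `h_q ≼ w`. -/
noncomputable def rank (w : List D) : ℕ := sSup { q : ℕ | dyckLE (harmonicW q) w }

/-!
STATEMENT 7: Define `P_0` to be the tree consisting of a root with a single leaf child,
and for `n ≥ 1` define `P_n` to be the tree whose root has two children: (in order) a
copy of `P_{n−1}`, and a node `n₂` which itself has two children, a copy of `P_{n−1}`
and a leaf. Then for all `n ≥ 0`, `dim(P_n) = n` and `osc(P_n) = n + 1`; hence the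
lower bound `osc(t) − 1 ≤ dim(t)` is attained with equality on this family.
-/

/-- Trees in which every node has 0, 1 or 2 children (footprint and dimension depend
only on the shape of a tree). -/
inductive T2 where
  | leaf : T2
  | uno : T2 → T2
  | duo : T2 → T2 → T2

/-- The footprint `α(n)` of a node: `α(n) = a` for a leaf and
`α(n) = a ā^k α(n₁) … α(n_k)` for a node with `k` children. -/
def alpha2 : T2 → List D
  | .leaf => [D.a]
  | .uno t => D.a :: D.ab :: alpha2 t
  | .duo t₁ t₂ => D.a :: D.ab :: D.ab :: (alpha2 t₁ ++ alpha2 t₂)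

/-- The footprint of the tree `t` with root `n`: `α(t) = ā α(n)`. -/
def alphaT2 (t : T2) : List D := D.ab :: alpha2 t

/-- The oscillation of a tree: `osc(t) = rank(α(t))`. -/
noncomputable def osc2 (t : T2) : ℕ := rank (alphaT2 t)

/-- The dimension: 0 for a leaf; for a node with children `n₁, …, n_k` (`k ≥ 1`), the
maximum of the children's dimensions if it is attained by a unique child, and that
maximum plus one otherwise (for one child the maximum is trivially unique). -/
def dim2 : T2 → ℕ
  | .leaf => 0
  | .uno t => dim2 t
  | .duo t₁ t₂ => if dim2 t₁ = dim2 t₂ then dim2 t₁ + 1 else max (dim2 t₁) (dim2 t₂)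

/-- The family `P_n`. -/
def Pfam : ℕ → T2
  | 0 => .uno .leaf
  | n + 1 => .duo (Pfam n) (.duo (Pfam n) .leaf)

/-- The maximal excess of `ā` over `a` among the prefixes of a word. -/
def height : List D → ℕ
  | [] => 0
  | .ab :: w => height w + 1
  | .a :: w => height w - 1

theorem height_append_mono (u : List D) {x y : List D} (h : height x ≤ height y) :
    height (u ++ x) ≤ height (u ++ y) := by
  induction u with
  | nil => exact h
  | cons c u ih => cases c <;> simp only [List.cons_append, height] <;> omega

theorem height_append_le (u z : List D) :
    height (u ++ z) ≤ height (u ++ D.a :: z) + 1 := by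
  induction u with
  | nil => simp only [List.nil_append, height]; omega
  | cons c u ih => cases c <;> simp only [List.cons_append, height] <;> omega

theorem height_le_height_append (u v : List D) : height u ≤ height (u ++ v) := by
  simpa using height_append_mono u (x := []) (y := v) (Nat.zero_le _)

theorem Matches.exists_split {t : DyckTree} {i j : ℕ} (h : Matches t i j) :
    ∃ u v z : List D, t.yield = u ++ D.ab :: (v ++ D.a :: z) ∧ i = u.length ∧
      j = u.length + (v.length + 1) := by
  induction h with
  | head t₁ t₂ => exact ⟨[], t₁.yield, t₂.yield, rfl, rfl, by simp⟩
  | left t₂ _ ih =>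
    obtain ⟨u, v, z, h, hi, hj⟩ := ih
    exact ⟨D.ab :: u, v, z ++ D.a :: t₂.yield, by simp [DyckTree.yield, h],
      by simp [hi], by simp only [List.length_cons]; omega⟩
  | right t₁ _ ih =>
    obtain ⟨u, v, z, h, hi, hj⟩ := ih
    refine ⟨D.ab :: (t₁.yield ++ D.a :: u), v, z, by simp [DyckTree.yield, h], ?_, ?_⟩ <;>
      simp only [List.length_cons, List.length_append] <;> omega

theorem eraseIdx_eraseIdx_split (u v z : List D) :
    ((u ++ D.ab :: (v ++ D.a :: z)).eraseIdx (u.length + (v.length + 1))).eraseIdx u.length =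
      u ++ (v ++ z) := by
  simp [List.eraseIdx_append_of_length_le]

theorem DelStep.height_le {w v : List D} (h : DelStep w v) : height v ≤ height w := by
  obtain ⟨t, i, j, rfl, hm, rfl⟩ := h
  obtain ⟨u, v, z, ht, rfl, rfl⟩ := hm.exists_split
  rw [ht, eraseIdx_eraseIdx_split]
  exact height_append_mono u (height_append_le v z)

theorem dyckLE.height_le {v w : List D} (h : dyckLE v w) : height v ≤ height w := by
  induction h with
  | refl => exact le_rfl
  | tail _ hs ih => exact hs.height_le.trans ih

theorem DelStep.left {w v : List D} (t : DyckTree) (h : DelStep w v) :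
    DelStep (D.ab :: (w ++ D.a :: t.yield)) (D.ab :: (v ++ D.a :: t.yield)) := by
  obtain ⟨s, i, j, rfl, hm, rfl⟩ := h
  refine ⟨.node s t, i + 1, j + 1, rfl, .left t hm, ?_⟩
  obtain ⟨u, v, z, hs, rfl, rfl⟩ := hm.exists_split
  have := eraseIdx_eraseIdx_split (D.ab :: u) v (z ++ D.a :: t.yield)
  rw [hs, eraseIdx_eraseIdx_split]
  simpa [add_right_comm] using this.symm

theorem DelStep.right {w v : List D} (t : DyckTree) (h : DelStep w v) :
    DelStep (D.ab :: (t.yield ++ D.a :: w)) (D.ab :: (t.yield ++ D.a :: v)) := by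
  obtain ⟨s, i, j, rfl, hm, rfl⟩ := h
  refine ⟨.node t s, _, _, rfl, .right t hm, ?_⟩
  obtain ⟨u, v, z, hs, rfl, rfl⟩ := hm.exists_split
  have := eraseIdx_eraseIdx_split (D.ab :: (t.yield ++ D.a :: u)) v z
  rw [hs, eraseIdx_eraseIdx_split]
  convert this.symm using 2
  · simp
  · congr 1
    · simp
    · simp only [List.length_cons, List.length_append]; omega
  · simp only [List.length_cons, List.length_append]; omega

theorem dyckLE.left {v w : List D} (t : DyckTree) (h : dyckLE v w) :
    dyckLE (D.ab :: (v ++ D.a :: t.yield)) (D.ab :: (w ++ D.a :: t.yield)) :=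
  Relation.ReflTransGen.lift (fun x => D.ab :: (x ++ D.a :: t.yield))
    (fun _ _ => DelStep.left t) _ _ h

theorem dyckLE.right {v w : List D} (t : DyckTree) (h : dyckLE v w) :
    dyckLE (D.ab :: (t.yield ++ D.a :: v)) (D.ab :: (t.yield ++ D.a :: w)) :=
  Relation.ReflTransGen.lift (fun x => D.ab :: (t.yield ++ D.a :: x))
    (fun _ _ => DelStep.right t) _ _ h

/-- The parse tree of the harmonic `h_i`. -/
def harmonicTree : ℕ → DyckTree
  | 0 => .eps
  | i + 1 => .node (harmonicTree i) (.node (harmonicTree i) .eps)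

theorem yield_harmonicTree (i : ℕ) : (harmonicTree i).yield = harmonicW i := by
  induction i with
  | zero => rfl
  | succ i ih => simp [harmonicTree, DyckTree.yield, harmonicW, ih]

/-- The parse tree of the footprint of `P_n`. -/
def PfamFootprintTree : ℕ → DyckTree
  | 0 => .node .eps (.node .eps .eps)
  | n + 1 => .node .eps (.node (PfamFootprintTree n) (.node (PfamFootprintTree n) .eps))

theorem yield_PfamFootprintTree (n : ℕ) : (PfamFootprintTree n).yield = alphaT2 (Pfam n) := by
  induction n with
  | zero => rfl
  | succ n ih => simp [PfamFootprintTree, DyckTree.yield, Pfam, alphaT2, alpha2, ih]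

theorem harmonicW_dyckLE_alphaT2_Pfam (n : ℕ) :
    dyckLE (harmonicW (n + 1)) (alphaT2 (Pfam n)) := by
  induction n with
  | zero => exact .refl
  | succ n ih =>
    rw [← yield_harmonicTree, ← yield_PfamFootprintTree] at ih ⊢
    set H := harmonicTree (n + 1)
    set W := PfamFootprintTree n
    have del : DelStep (PfamFootprintTree (n + 1)).yield
        (DyckTree.node W (.node W .eps)).yield :=
      ⟨_, 0, 1, rfl, .head _ _, rfl⟩
    have hl : dyckLE (DyckTree.node H (.node W .eps)).yield
        (DyckTree.node W (.node W .eps)).yield := ih.left _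
    have hr : dyckLE (DyckTree.node H (.node H .eps)).yield
        (DyckTree.node H (.node W .eps)).yield := (ih.left .eps).right H
    exact (hl.trans hr).head del

theorem le_height_harmonicW (q : ℕ) : q ≤ height (harmonicW q) := by
  induction q with
  | zero => exact Nat.zero_le _
  | succ q ih =>
    simp only [harmonicW, List.cons_append, List.append_assoc, height]
    exact Nat.succ_le_succ (ih.trans (height_le_height_append _ _))

theorem height_alphaT2_Pfam_append_le (n : ℕ) (v : List D) :
    height (alphaT2 (Pfam n) ++ v) ≤ max (n + 1) (height v) := by
  induction n generalizing v with
  | zero => simp only [Pfam, alphaT2, alpha2, List.cons_append, List.nil_append, height]; omega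
  | succ n ih =>
    have h₁ := ih (D.a :: v)
    have h₂ := ih (D.a :: D.ab :: (alphaT2 (Pfam n) ++ D.a :: v))
    simp only [Pfam, alphaT2, alpha2, List.cons_append, List.nil_append, List.append_assoc,
      height] at h₁ h₂ ⊢
    omega

theorem dim2_Pfam (n : ℕ) : dim2 (Pfam n) = n := by
  induction n with
  | zero => rfl
  | succ n ih =>
    simp only [Pfam, dim2, ih]
    split_ifs <;> omega

theorem osc2_Pfam (n : ℕ) : osc2 (Pfam n) = n + 1 := by
  refine IsGreatest.csSup_eq ⟨harmonicW_dyckLE_alphaT2_Pfam n, fun q hq => ?_⟩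
  have h := height_alphaT2_Pfam_append_le n []
  rw [List.append_nil] at h
  exact (le_height_harmonicW q).trans (hq.height_le.trans (by simpa [height] using h))

theorem Pfam_dim_osc :
    ∀ n : ℕ, dim2 (Pfam n) = n ∧ osc2 (Pfam n) = n + 1 :=
  fun n => ⟨dim2_Pfam n, osc2_Pfam n⟩
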